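/- The symmetric border rank of sM^{S,0}_4 satisfies uR_s(sM^{S,0}_4) ≥ 14: the cubic polynomial A ↦ trace(A^3) on the 9-dimensional space of traceless symmetric 4×4 complex matrices does not lie in the closure of the set of cubics of symmetric rank at most 13. -/

import Mathlib

open Filter Matrix

/-- Symmetric border rank of a cubic polynomial: the smallest `r` such that `P` is a
limit of cubics of symmetric rank at most `r` (pointwise convergence, which on the
finite-dimensional space of cubics agrees with the usual topology). -/
noncomputable def symBorderRank {W : Type*} [AddCommGroup W] [Module ℂ W]
    (P : W → ℂ) : ℕ :=
  sInf {r : ℕ | ∃ ℓ : ℕ → Fin r → (W →ₗ[ℂ] ℂ),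
    ∀ a, Tendsto (fun m => ∑ i, (ℓ m i a) ^ 3) atTop (nhds (P a))}

/-- The space of traceless symmetric n×n complex matrices. -/
noncomputable def symMat0 (n : ℕ) : Submodule ℂ (Matrix (Fin n) (Fin n) ℂ) where
  carrier := {A | Aᵀ = A ∧ A.trace = 0}
  add_mem' := by
    intro a b ha hb
    simp only [Set.mem_setOf_eq] at *
    rw [Matrix.transpose_add, Matrix.trace_add, ha.1, hb.1, ha.2, hb.2]
    simp
  zero_mem' := by simp
  smul_mem' := by
    intro c A hA
    simp only [Set.mem_setOf_eq] at *
    rw [Matrix.transpose_smul, Matrix.trace_smul, hA.1, hA.2]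
    simp

/-- `sM^{S,0}_n`: the restriction of `sM_n` to traceless symmetric matrices. -/
noncomputable def sMS0 (n : ℕ) : symMat0 n → ℂ :=
  fun A => ((A : Matrix (Fin n) (Fin n) ℂ) ^ 3).trace

def kz {R : Type*} [CommRing R] (x : Fin 5 → R) : Matrix (Fin 10) (Fin 10) R :=
  !![x 2, x 3, x 4, 0, 0, 0, 0, 0, 0, 0;
    -x 1, 0, 0, x 3, x 4, 0, 0, 0, 0, 0;
    0, -x 1, 0, -x 2, 0, x 4, 0, 0, 0, 0;
    0, 0, -x 1, 0, -x 2, -x 3, 0, 0, 0, 0;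
    x 0, 0, 0, 0, 0, 0, x 3, x 4, 0, 0;
    0, x 0, 0, 0, 0, 0, -x 2, 0, x 4, 0;
    0, 0, x 0, 0, 0, 0, 0, -x 2, -x 3, 0;
    0, 0, 0, x 0, 0, 0, x 1, 0, 0, x 4;
    0, 0, 0, 0, x 0, 0, 0, x 1, 0, -x 3;
    0, 0, 0, 0, 0, x 0, 0, 0, x 1, x 2]

def kzB0 {R : Type*} [CommRing R] (x : Fin 5 → R) : Matrix (Fin 10) (Fin 6) R :=
  !![x 2, x 3, x 4, 0, 0, 0;
    -x 1, 0, 0, x 3, x 4, 0;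
    0, -x 1, 0, -x 2, 0, x 4;
    0, 0, -x 1, 0, -x 2, -x 3;
    x 0, 0, 0, 0, 0, 0;
    0, x 0, 0, 0, 0, 0;
    0, 0, x 0, 0, 0, 0;
    0, 0, 0, x 0, 0, 0;
    0, 0, 0, 0, x 0, 0;
    0, 0, 0, 0, 0, x 0]

def kzQ0 : Fin 6 → Fin 10 := ![4, 5, 6, 7, 8, 9]

def kzB1 {R : Type*} [CommRing R] (x : Fin 5 → R) : Matrix (Fin 10) (Fin 6) R :=
  !![-x 2, -x 3, -x 4, 0, 0, 0;
    x 1, 0, 0, 0, 0, 0;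
    0, x 1, 0, 0, 0, 0;
    0, 0, x 1, 0, 0, 0;
    -x 0, 0, 0, x 3, x 4, 0;
    0, -x 0, 0, -x 2, 0, x 4;
    0, 0, -x 0, 0, -x 2, -x 3;
    0, 0, 0, x 1, 0, 0;
    0, 0, 0, 0, x 1, 0;
    0, 0, 0, 0, 0, x 1]

def kzQ1 : Fin 6 → Fin 10 := ![1, 2, 3, 7, 8, 9]

def kzB2 {R : Type*} [CommRing R] (x : Fin 5 → R) : Matrix (Fin 10) (Fin 6) R :=
  !![x 2, 0, 0, 0, 0, 0;
    -x 1, -x 3, -x 4, 0, 0, 0;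
    0, x 2, 0, 0, 0, 0;
    0, 0, x 2, 0, 0, 0;
    x 0, 0, 0, -x 3, -x 4, 0;
    0, 0, 0, x 2, 0, 0;
    0, 0, 0, 0, x 2, 0;
    0, -x 0, 0, -x 1, 0, x 4;
    0, 0, -x 0, 0, -x 1, -x 3;
    0, 0, 0, 0, 0, x 2]

def kzQ2 : Fin 6 → Fin 10 := ![0, 2, 3, 5, 6, 9]

def kzB3 {R : Type*} [CommRing R] (x : Fin 5 → R) : Matrix (Fin 10) (Fin 6) R :=
  !![x 3, 0, 0, 0, 0, 0;
    0, x 3, 0, 0, 0, 0;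
    -x 1, -x 2, -x 4, 0, 0, 0;
    0, 0, x 3, 0, 0, 0;
    0, 0, 0, x 3, 0, 0;
    x 0, 0, 0, -x 2, -x 4, 0;
    0, 0, 0, 0, x 3, 0;
    0, x 0, 0, x 1, 0, -x 4;
    0, 0, 0, 0, 0, x 3;
    0, 0, -x 0, 0, -x 1, -x 2]

def kzQ3 : Fin 6 → Fin 10 := ![0, 1, 3, 4, 6, 8]

def kzB4 {R : Type*} [CommRing R] (x : Fin 5 → R) : Matrix (Fin 10) (Fin 6) R :=
  !![x 4, 0, 0, 0, 0, 0;
    0, x 4, 0, 0, 0, 0;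
    0, 0, x 4, 0, 0, 0;
    -x 1, -x 2, -x 3, 0, 0, 0;
    0, 0, 0, x 4, 0, 0;
    0, 0, 0, 0, x 4, 0;
    x 0, 0, 0, -x 2, -x 3, 0;
    0, 0, 0, 0, 0, x 4;
    0, x 0, 0, x 1, 0, -x 3;
    0, 0, x 0, 0, x 1, x 2]

def kzQ4 : Fin 6 → Fin 10 := ![0, 1, 2, 4, 5, 7]

def rowList : List (Fin 10 × Fin 9) :=
  [(5, 2), (6, 1), (8, 0), (2, 2), (9, 3), (8, 4), (3, 1), (6, 4), (6, 5), (7, 6), (3, 7), (6, 2), (6, 0), (7, 0), (3, 0), (9, 6), (0, 2), (9, 1), (5, 4), (4, 2), (5, 5), (5, 0), (9, 2), (4, 5), (2, 0), (6, 3), (2, 8), (4, 4), (1, 2), (2, 5), (5, 8), (5, 7), (2, 4), (2, 7), (3, 8), (4, 1), (6, 7), (3, 4), (1, 1), (2, 1), (3, 5), (3, 2), (0, 0), (4, 3), (8, 5), (4, 0), (9, 4), (6, 6), (8, 2), (3, 3), (6, 8), (4, 7), (1, 4), (1, 7), (3, 6), (9, 7), (1, 0), (7, 1), (9, 8), (2,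 3), (7, 2), (9, 5), (4, 6), (7, 4), (8, 8), (7, 7), (0, 5), (1, 6), (0, 4), (0, 7), (2, 6), (1, 5), (1, 8), (7, 8), (5, 3), (0, 8), (8, 7), (7, 5), (0, 1)]

def colList : List (Fin 10 × Fin 9) :=
  [(1, 7), (2, 8), (9, 8), (1, 4), (9, 7), (7, 2), (2, 5), (7, 6), (8, 6), (9, 1), (4, 3), (2, 7), (8, 8), (9, 4), (5, 8), (9, 5), (1, 6), (8, 5), (6, 6), (0, 7), (8, 7), (8, 4), (5, 7), (7, 7), (5, 4), (7, 8), (3, 3), (7, 0), (3, 6), (1, 1), (6, 3), (1, 2), (5, 0), (5, 5), (5, 3), (0, 8), (2, 2), (4, 6), (0, 5), (5, 6), (2, 1), (2, 4), (1, 8), (7, 1), (9, 6), (7, 4), (8, 2), (7, 5), (4, 7), (4, 8), (8, 3), (0, 2), (4, 0), (4, 5), (4, 4), (9, 3), (3, 8), (6, 5), (5, 1), (3, 7), (6, 4), (8, 1), (6, 2), (9, 0), (4, 1), (3, 2), (0, 6), (3, 5), (2, 0), (0, 3), (3, 4), (0, 1), (3, 0), (3, 1), (6, 7), (1, 3), (4,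 2), (6, 1), (2, 3)]

def uvec : Fin 5 → Fin 9 → ℤ :=
  ![![0, 0, 0, 1, 0, 0, 0, 0, 0],
    ![0, 0, 0, 0, 0, 0, 1, 0, 0],
    ![0, -1, 1, 0, 0, 0, 0, 0, 0],
    ![0, 1, 0, 0, 1, 0, 0, 0, 0],
    ![1, 0, 0, 0, 0, -1, 0, 0, -1]]

theorem kz_id0 (x : Fin 5 → ℂ) :
    x 0 • kz x = kzB0 x * (kz x).submatrix kzQ0 id := by
  ext i j
  rw [Matrix.mul_apply, Fin.sum_univ_six]
  fin_cases i <;> fin_cases j <;> simp [kz, kzB0, kzQ0] <;> ring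

theorem kz_id1 (x : Fin 5 → ℂ) :
    x 1 • kz x = kzB1 x * (kz x).submatrix kzQ1 id := by
  ext i j
  rw [Matrix.mul_apply, Fin.sum_univ_six]
  fin_cases i <;> fin_cases j <;> simp [kz, kzB1, kzQ1] <;> ring

theorem kz_id2 (x : Fin 5 → ℂ) :
    x 2 • kz x = kzB2 x * (kz x).submatrix kzQ2 id := by
  ext i j
  rw [Matrix.mul_apply, Fin.sum_univ_six]
  fin_cases i <;> fin_cases j <;> simp [kz, kzB2, kzQ2] <;> ring

theorem kz_id3 (x : Fin 5 → ℂ) :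
    x 3 • kz x = kzB3 x * (kz x).submatrix kzQ3 id := by
  ext i j
  rw [Matrix.mul_apply, Fin.sum_univ_six]
  fin_cases i <;> fin_cases j <;> simp [kz, kzB3, kzQ3] <;> ring

theorem kz_id4 (x : Fin 5 → ℂ) :
    x 4 • kz x = kzB4 x * (kz x).submatrix kzQ4 id := by
  ext i j
  rw [Matrix.mul_apply, Fin.sum_univ_six]
  fin_cases i <;> fin_cases j <;> simp [kz, kzB4, kzQ4] <;> ring

theorem kz_factor (x : Fin 5 → ℂ) :
    ∃ (A : Matrix (Fin 10) (Fin 6) ℂ) (B : Matrix (Fin 6) (Fin 10) ℂ), kz x = A * B := by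
  have key : ∀ (c : ℂ) (A : Matrix (Fin 10) (Fin 6) ℂ) (B : Matrix (Fin 6) (Fin 10) ℂ),
      c ≠ 0 → c • kz x = A * B → ∃ (A : Matrix (Fin 10) (Fin 6) ℂ)
        (B : Matrix (Fin 6) (Fin 10) ℂ), kz x = A * B := by
    intro c A B hc h
    refine ⟨c⁻¹ • A, B, ?_⟩
    rw [Matrix.smul_mul, ← h, smul_smul, inv_mul_cancel₀ hc, one_smul]
  by_cases h0 : x 0 = 0
  · by_cases h1 : x 1 = 0
    · by_cases h2 : x 2 = 0
      · by_cases h3 : x 3 = 0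
        · by_cases h4 : x 4 = 0
          · refine ⟨0, 0, ?_⟩
            ext i j
            fin_cases i <;> fin_cases j <;> simp [kz, h0, h1, h2, h3, h4]
          · exact key _ _ _ h4 (kz_id4 x)
        · exact key _ _ _ h3 (kz_id3 x)
      · exact key _ _ _ h2 (kz_id2 x)
    · exact key _ _ _ h1 (kz_id1 x)
  · exact key _ _ _ h0 (kz_id0 x)

set_option maxHeartbeats 2000000 in
theorem kz_expand {R : Type*} [CommRing R] (x : Fin 5 → R) (S T : Fin 10) :
    kz x S T = ∑ m, x m * kz (Pi.single m 1 : Fin 5 → R) S T := by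
  rw [Fin.sum_univ_five]
  fin_cases S <;> fin_cases T <;> simp [kz]

theorem kz_cast (x : Fin 5 → ℤ) (S T : Fin 10) :
    kz (fun m => (x m : ℂ)) S T = ((kz x S T : ℤ) : ℂ) := by
  fin_cases S <;> fin_cases T <;> simp [kz]

/-- Full polarization of a cubic. -/
def pol {V R : Type*} [AddCommGroup V] [CommRing R] (f : V → R) (a b c : V) : R :=
  f (a + b + c) - f (a + b) - f (a + c) - f (b + c) + f a + f b + f c

/-- The 3×3 determinant in coordinates. -/
def det9 {R : Type*} [CommRing R] (x : Fin 9 → R) : R :=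
  x 0 * (x 4 * x 8 - x 5 * x 7) - x 1 * (x 3 * x 8 - x 5 * x 6)
    + x 2 * (x 3 * x 7 - x 4 * x 6)

/-- Polarization of the determinant, in its first two arguments a general vector and a
basis vector. -/
def slc (m : Fin 5) (i j : Fin 9) : ℤ :=
  pol det9 (uvec m) (Pi.single i 1) (Pi.single j 1)

def rIdx (a : Fin 79) : Fin 10 × Fin 9 := rowList.getD a.val (0, 0)
def cIdx (a : Fin 79) : Fin 10 × Fin 9 := colList.getD a.val (0, 0)

def Nint (a b : Fin 79) : ℤ :=
  kz (fun m => slc m (rIdx a).2 (cIdx b).2) (rIdx a).1 (cIdx b).1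

set_option maxRecDepth 100000 in
theorem Nint_tri : ∀ a b : Fin 79, a < b → Nint a b = 0 := by
  decide +kernel

set_option maxRecDepth 100000 in
theorem Nint_diag : ∀ a : Fin 79, Nint a a ≠ 0 := by
  decide +kernel

theorem pol_cube {V ι : Type*} [AddCommGroup V] [Module ℂ V] [Fintype ι]
    (ℓ : ι → (V →ₗ[ℂ] ℂ)) (a b c : V) :
    pol (fun v => ∑ k, (ℓ k v) ^ 3) a b c = ∑ k, 6 * (ℓ k a * ℓ k b * ℓ k c) := by
  simp only [pol, ← Finset.sum_sub_distrib, ← Finset.sum_add_distrib]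
  refine Finset.sum_congr rfl fun k _ => ?_
  simp only [map_add]
  ring

/-- The chosen 79×79 minor of the Koszul flattening of `f`. -/
def flatMinor {V : Type*} [AddCommGroup V] (u : Fin 5 → V) (e : Fin 9 → V) (f : V → ℂ) :
    Matrix (Fin 79) (Fin 79) ℂ :=
  Matrix.of fun a b =>
    kz (fun m => pol f (u m) (e (rIdx a).2) (e (cIdx b).2)) (rIdx a).1 (cIdx b).1

theorem kz_sum {ι : Type*} [Fintype ι] (y : ι → Fin 5 → ℂ) (c : ι → ℂ) (S T : Fin 10) :
    kz (fun m => ∑ k, y k m * c k) S T = ∑ k, kz (y k) S T * c k := by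
  rw [kz_expand]
  simp_rw [fun k => kz_expand (y k) S T, Finset.sum_mul]
  rw [Finset.sum_comm]
  refine Finset.sum_congr rfl fun k _ => Finset.sum_congr rfl fun m _ => ?_
  ring

theorem flatMinor_det_zero {V : Type*} [AddCommGroup V] [Module ℂ V] (u : Fin 5 → V)
    (e : Fin 9 → V) (r : ℕ) (hr : r < 14) (ℓ : Fin r → (V →ₗ[ℂ] ℂ)) :
    (flatMinor u e (fun v => ∑ k, (ℓ k v) ^ 3)).det = 0 := by
  choose A B hAB using fun k => kz_factor (fun m => ℓ k (u m))
  have hfac : flatMinor u e (fun v => ∑ k, (ℓ k v) ^ 3)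
      = (Matrix.of fun (a : Fin 79) (q : Fin r × Fin 6) =>
          A q.1 (rIdx a).1 q.2 * ℓ q.1 (e (rIdx a).2)) *
        (Matrix.of fun (q : Fin r × Fin 6) (b : Fin 79) =>
          B q.1 q.2 (cIdx b).1 * (6 * ℓ q.1 (e (cIdx b).2))) := by
    ext a b
    simp only [flatMinor, Matrix.of_apply, pol_cube, Matrix.mul_apply, Fintype.sum_prod_type]
    have h1 : (fun m => ∑ k, 6 * (ℓ k (u m) * ℓ k (e (rIdx a).2) * ℓ k (e (cIdx b).2)))
        = fun m => ∑ k, (fun k m => ℓ k (u m)) k m *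
          (fun k => 6 * (ℓ k (e (rIdx a).2) * ℓ k (e (cIdx b).2))) k := by
      funext m
      refine Finset.sum_congr rfl fun k _ => ?_
      ring
    rw [h1, kz_sum]
    refine Finset.sum_congr rfl fun k _ => ?_
    rw [hAB k, Matrix.mul_apply, Finset.sum_mul]
    refine Finset.sum_congr rfl fun q _ => ?_
    ring
  by_contra hdet
  have h1 := Matrix.rank_of_det_ne_zero hdet
  rw [hfac] at h1
  have h2 := (Matrix.rank_mul_le_left (Matrix.of fun (a : Fin 79) (q : Fin r × Fin 6) =>
          A q.1 (rIdx a).1 q.2 * ℓ q.1 (e (rIdx a).2)) (Matrix.of fun (q : Fin r × Fin 6) (b : Fin 79) =>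
          B q.1 q.2 (cIdx b).1 * (6 * ℓ q.1 (e (cIdx b).2)))).trans
    (Matrix.rank_le_card_width _)
  rw [h1] at h2
  simp only [Fintype.card_fin, Fintype.card_prod] at h2
  omega

/-- The isomorphism between 3×3 matrices and traceless symmetric 4×4 matrices. -/
def hornMat (x : Fin 9 → ℂ) : Matrix (Fin 4) (Fin 4) ℂ :=
  !![x 0 + x 4 + x 8, x 5 - x 7, x 6 - x 2, x 1 - x 3;
     x 5 - x 7, x 0 - x 4 - x 8, x 1 + x 3, x 6 + x 2;
     x 6 - x 2, x 1 + x 3, -x 0 + x 4 - x 8, x 5 + x 7;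
     x 1 - x 3, x 6 + x 2, x 5 + x 7, -x 0 - x 4 + x 8]

theorem hornMat_mem (x : Fin 9 → ℂ) : hornMat x ∈ symMat0 4 := by
  constructor
  · ext i j
    fin_cases i <;> fin_cases j <;> simp [hornMat]
  · simp [hornMat, Matrix.trace, Fin.sum_univ_four]
    ring

theorem hornMat_add (x y : Fin 9 → ℂ) : hornMat (x + y) = hornMat x + hornMat y := by
  ext i j
  fin_cases i <;> fin_cases j <;> simp [hornMat] <;> ring

noncomputable def horn (x : Fin 9 → ℂ) : symMat0 4 := ⟨hornMat x, hornMat_mem x⟩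

theorem horn_add (x y : Fin 9 → ℂ) : horn (x + y) = horn x + horn y :=
  Subtype.ext (hornMat_add x y)

theorem trace_cube (A : Matrix (Fin 4) (Fin 4) ℂ) :
    (A ^ 3).trace = ∑ i, ∑ j, ∑ k, A i j * A j k * A k i := by
  simp only [pow_succ, pow_zero, one_mul, Matrix.trace, Matrix.diag, Matrix.mul_apply,
    Finset.sum_mul]
  refine Finset.sum_congr rfl fun i _ => ?_
  rw [Finset.sum_comm]

theorem sMS0_horn (x : Fin 9 → ℂ) : sMS0 4 (horn x) = 24 * det9 x := by
  simp only [sMS0, horn, trace_cube]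
  simp [Fin.sum_univ_four, hornMat, det9]
  ring

theorem pol_horn (a b c : Fin 9 → ℂ) :
    pol (sMS0 4) (horn a) (horn b) (horn c) = 24 * pol det9 a b c := by
  simp only [pol, ← horn_add, sMS0_horn]
  ring

theorem pol_cast (a b c : Fin 9 → ℤ) :
    pol det9 (fun i => (a i : ℂ)) (fun i => (b i : ℂ)) (fun i => (c i : ℂ))
      = ((pol det9 a b c : ℤ) : ℂ) := by
  simp [pol, det9]

noncomputable def uW (m : Fin 5) : symMat0 4 := horn fun i => (uvec m i : ℂ)
noncomputable def eW (j : Fin 9) : symMat0 4 :=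
  horn fun i => (((Pi.single j 1 : Fin 9 → ℤ) i : ℤ) : ℂ)

theorem flatMinor_limit :
    flatMinor uW eW (sMS0 4) = Matrix.of fun a b => (24 : ℂ) * ((Nint a b : ℤ) : ℂ) := by
  ext a b
  simp only [flatMinor, Matrix.of_apply, uW, eW, pol_horn, pol_cast]
  have h := kz_sum (ι := Unit) (fun _ m => ((slc m (rIdx a).2 (cIdx b).2 : ℤ) : ℂ))
    (fun _ => 24) (rIdx a).1 (cIdx b).1
  simp only [Finset.univ_unique, Finset.sum_singleton, kz_cast] at h
  simp only [mul_comm (24 : ℂ)]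
  exact h

theorem flatMinor_limit_det : (flatMinor uW eW (sMS0 4)).det ≠ 0 := by
  rw [flatMinor_limit, Matrix.det_of_isLowerTriangular]
  · rw [Finset.prod_ne_zero_iff]
    intro a _
    simpa using Nint_diag a
  · intro a b hab
    have : a < b := hab
    simp [Nint_tri a b this]

theorem tendsto_kz {F : ℕ → Fin 5 → ℂ} {x : Fin 5 → ℂ}
    (h : ∀ m, Tendsto (fun n => F n m) atTop (nhds (x m))) (S T : Fin 10) :
    Tendsto (fun n => kz (F n) S T) atTop (nhds (kz x S T)) := by
  rw [kz_expand x]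
  simp_rw [fun n => kz_expand (F n) S T]
  exact tendsto_finsetSum _ fun m _ => (h m).mul_const _

theorem tendsto_det {n : ℕ} {F : ℕ → Matrix (Fin n) (Fin n) ℂ} {M : Matrix (Fin n) (Fin n) ℂ}
    (h : Tendsto F atTop (nhds M)) : Tendsto (fun k => (F k).det) atTop (nhds M.det) :=
  ((Continuous.matrix_det continuous_id).tendsto M).comp h

theorem not_limit (r : ℕ) (hr : r < 14) (ℓ : ℕ → Fin r → (symMat0 4 →ₗ[ℂ] ℂ))
    (h : ∀ a, Tendsto (fun m => ∑ i, (ℓ m i a) ^ 3) atTop (nhds (sMS0 4 a))) : False := by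
  have hM : Tendsto (fun n => flatMinor uW eW (fun v => ∑ k, (ℓ n k v) ^ 3)) atTop
      (nhds (flatMinor uW eW (sMS0 4))) := by
    refine tendsto_pi_nhds.2 fun a => tendsto_pi_nhds.2 fun b => ?_
    simp only [flatMinor, Matrix.of_apply]
    refine tendsto_kz (fun m => ?_) _ _
    simp only [pol]
    exact ((((((h _).sub (h _)).sub (h _)).sub (h _)).add (h _)).add (h _)).add (h _)
  have hd : Tendsto (fun n => (flatMinor uW eW (fun v => ∑ k, (ℓ n k v) ^ 3)).det) atTop
      (nhds (flatMinor uW eW (sMS0 4)).det) :=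
    tendsto_det hM
  simp only [flatMinor_det_zero uW eW r hr] at hd
  exact flatMinor_limit_det (tendsto_nhds_unique hd tendsto_const_nhds)

/-- Coordinate functionals. -/
noncomputable def coord (i j : Fin 4) : symMat0 4 →ₗ[ℂ] ℂ :=
  (Matrix.entryLinearMap ℂ ℂ i j).comp (symMat0 4).subtype

/-- Every trilinear monomial is a sum of four cubes. -/
theorem mono_waring (a b c : symMat0 4 →ₗ[ℂ] ℂ) :
    ∃ ℓ : Fin 4 → (symMat0 4 →ₗ[ℂ] ℂ), ∀ v, ∑ i, (ℓ i v) ^ 3 = a v * b v * c v := by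
  obtain ⟨z, hz⟩ := IsAlgClosed.exists_pow_nat_eq (1 / 24 : ℂ) (n := 3) (by norm_num)
  refine ⟨![z • (a + b + c), z • (c - a - b), z • (b - a - c), z • (a - b - c)], fun v => ?_⟩
  simp [Fin.sum_univ_four]
  linear_combination ((a v + b v + c v) ^ 3 + (c v - a v - b v) ^ 3 + (b v - a v - c v) ^ 3
    + (a v - b v - c v) ^ 3) * hz

theorem waring_nonempty : {r : ℕ | ∃ ℓ : ℕ → Fin r → (symMat0 4 →ₗ[ℂ] ℂ),
    ∀ a, Tendsto (fun m => ∑ i, (ℓ m i a) ^ 3) atTop (nhds (sMS0 4 a))}.Nonempty := by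
  choose ℓ hℓ using fun t : Fin 4 × Fin 4 × Fin 4 =>
    mono_waring (coord t.1 t.2.1) (coord t.2.1 t.2.2) (coord t.2.2 t.1)
  let ε := (Fintype.equivFin ((Fin 4 × Fin 4 × Fin 4) × Fin 4)).symm
  refine ⟨_, fun _ i => ℓ (ε i).1 (ε i).2, fun v => ?_⟩
  have : ∑ i, (ℓ (ε i).1 (ε i).2 v) ^ 3 = sMS0 4 v := by
    rw [Equiv.sum_comp ε (fun q => (ℓ q.1 q.2 v) ^ 3), Fintype.sum_prod_type]
    simp only [hℓ]
    simp only [Fintype.sum_prod_type, sMS0, trace_cube]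
    rfl
  simp only [this]
  exact tendsto_const_nhds

theorem symBorderRank_sMS0_4_ge : 14 ≤ symBorderRank (sMS0 4) := by
  by_contra hlt
  obtain ⟨ℓ, h⟩ := Nat.sInf_mem waring_nonempty
  exact not_limit _ (not_le.mp hlt) ℓ h
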